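/- Let (H,N) be a KVN-structure on a left-symmetric algebra A. Then for all k, i ∈ ℕ and all α,β ∈ A*: (N^k∘H^♯)(α ·^H_{(N*)^{k+i}} β) = (N^k∘H^♯)(α) ·_{N^i} (N^k∘H^♯)(β). -/

import Mathlib

open Module

variable {A : Type*} [AddCommGroup A] [Module ℝ A] [FiniteDimensional ℝ A]

/-- The product `mul` is left-symmetric: the associator is symmetric in its
first two arguments. -/
def IsLS (mul : A →ₗ[ℝ] A →ₗ[ℝ] A) : Prop :=
  ∀ x y z : A, mul x (mul y z) - mul (mul x y) z = mul y (mul x z) - mul (mul y x) z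

/-- The commutator bracket `[x,y] = x·y − y·x`. -/
def br (mul : A →ₗ[ℝ] A →ₗ[ℝ] A) (x y : A) : A := mul x y - mul y x

/-- `⟦H,H⟧(α₁,α₂,α₃)` over a point. -/
def KVbr (mul : A →ₗ[ℝ] A →ₗ[ℝ] A) (Hs : Dual ℝ A →ₗ[ℝ] A)
    (α₁ α₂ α₃ : Dual ℝ A) : ℝ :=
  α₁ (mul (Hs α₂) (Hs α₃)) - α₂ (mul (Hs α₁) (Hs α₃)) - α₃ (br mul (Hs α₁) (Hs α₂))

/-- `H^♯` encodes a symmetric 2-tensor. -/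
def IsSymmT (Hs : Dual ℝ A →ₗ[ℝ] A) : Prop :=
  ∀ α β : Dual ℝ A, α (Hs β) = β (Hs α)

/-- `H` is a Koszul-Vinberg structure: `⟦H,H⟧ = 0`. -/
def IsKV (mul : A →ₗ[ℝ] A →ₗ[ℝ] A) (Hs : Dual ℝ A →ₗ[ℝ] A) : Prop :=
  ∀ α₁ α₂ α₃ : Dual ℝ A, KVbr mul Hs α₁ α₂ α₃ = 0

/-- The induced product on the dual: `(α ·^H β)(y) = −β([H^♯α, y]) + α(y · H^♯β)`. -/
def dualMul (mul : A →ₗ[ℝ] A →ₗ[ℝ] A) (Hs : Dual ℝ A →ₗ[ℝ] A)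
    (α β : Dual ℝ A) : Dual ℝ A :=
  -(β ∘ₗ (mul (Hs α) - mul.flip (Hs α))) + α ∘ₗ mul.flip (Hs β)

/-- Nijenhuis operator. -/
def IsNij (mul : A →ₗ[ℝ] A →ₗ[ℝ] A) (N : A →ₗ[ℝ] A) : Prop :=
  ∀ x y : A, mul (N x) (N y) = N (mul (N x) y + mul x (N y) - N (mul x y))

/-- Deformed product `x ·_N y = N(x)·y + x·N(y) − N(x·y)`. -/
def mulN (mul : A →ₗ[ℝ] A →ₗ[ℝ] A) (N : A →ₗ[ℝ] A) : A →ₗ[ℝ] A →ₗ[ℝ] A :=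
  mul ∘ₗ N + (mul.flip ∘ₗ N).flip - (LinearMap.llcomp ℝ A A A N) ∘ₗ mul

/-- Deformation of the dual product by an endomorphism `S` of the dual:
`α ·^H_S β = S(α) ·^H β + α ·^H S(β) − S(α ·^H β)`. -/
def dmulE (mul : A →ₗ[ℝ] A →ₗ[ℝ] A) (Hs : Dual ℝ A →ₗ[ℝ] A)
    (S : Dual ℝ A →ₗ[ℝ] Dual ℝ A) (α β : Dual ℝ A) : Dual ℝ A :=
  dualMul mul Hs (S α) β + dualMul mul Hs α (S β) - S (dualMul mul Hs α β)

/-- Koszul-Vinberg-Nijenhuis structure: `H` is KV, `N` is Nijenhuis,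
`N∘H^♯ = H^♯∘N*`, and `α ⋆^H β = α ·^H_{N*} β`.  (Note that
`α ⋆^H β = dualMul (mulN mul N) Hs α β`.) -/
def IsKVN (mul : A →ₗ[ℝ] A →ₗ[ℝ] A) (Hs : Dual ℝ A →ₗ[ℝ] A) (N : A →ₗ[ℝ] A) : Prop :=
  IsKV mul Hs ∧ IsNij mul N ∧ N ∘ₗ Hs = Hs ∘ₗ N.dualMap ∧
  ∀ α β : Dual ℝ A, dualMul (mulN mul N) Hs α β = dmulE mul Hs N.dualMap α β

/-- `2⟦H₁,H₂⟧(α₁,α₂,α₃)` over a point. -/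
noncomputable def KVbr2 (mul : A →ₗ[ℝ] A →ₗ[ℝ] A) (H1s H2s : Dual ℝ A →ₗ[ℝ] A)
    (α₁ α₂ α₃ : Dual ℝ A) : ℝ :=
  (α₁ (mul (H1s α₂) (H2s α₃)) + α₁ (mul (H2s α₂) (H1s α₃))
    - α₂ (mul (H1s α₁) (H2s α₃)) - α₂ (mul (H2s α₁) (H1s α₃))
    - α₃ (br mul (H1s α₁) (H2s α₂)) - α₃ (br mul (H2s α₁) (H1s α₂))) / 2

/-- A bilinear form (given via `𝔅^♮ : A → A*`) is a 2-cocycle: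
`𝔅(x, y·z) − 𝔅(y, x·z) − 𝔅([x,y], z) = 0`. -/
def IsCocycle (mul : A →ₗ[ℝ] A →ₗ[ℝ] A) (B : A →ₗ[ℝ] Dual ℝ A) : Prop :=
  ∀ x y z : A, B x (mul y z) - B y (mul x z) - B (br mul x y) z = 0

/-- Symmetry of a bilinear form. -/
def IsSymmB (B : A →ₗ[ℝ] Dual ℝ A) : Prop := ∀ x y : A, B x y = B y x

/-- KVB-structure: `𝔅` is a symmetric 2-cocycle and `𝔅_N`, with
`N = H^♯∘𝔅^♮`, is also a 2-cocycle. -/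
def IsKVB (mul : A →ₗ[ℝ] A →ₗ[ℝ] A) (Hs : Dual ℝ A →ₗ[ℝ] A)
    (B : A →ₗ[ℝ] Dual ℝ A) : Prop :=
  IsSymmB B ∧ IsCocycle mul B ∧ IsCocycle mul (B ∘ₗ (Hs ∘ₗ B))

/-- `𝔅` is complementary for `H`: `⟦𝔅,𝔅⟧_{A*} = 0`, written out over a point
with `T = H^♯∘𝔅^♮`. -/
def IsComplementary (mul : A →ₗ[ℝ] A →ₗ[ℝ] A) (Hs : Dual ℝ A →ₗ[ℝ] A)
    (B : A →ₗ[ℝ] Dual ℝ A) : Prop :=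
  ∀ x y z : A,
    -B (mul ((Hs ∘ₗ B) y) z) x - B (mul y ((Hs ∘ₗ B) z)) x
    + B (mul ((Hs ∘ₗ B) x) z) y + B (mul x ((Hs ∘ₗ B) z)) y
    + B (br mul ((Hs ∘ₗ B) x) y) z - B (br mul ((Hs ∘ₗ B) y) x) z = 0

/-- Pseudo-Hessian-Nijenhuis structure: `𝔅` a symmetric 2-cocycle, `N`
Nijenhuis, `𝔅(N x, y) = 𝔅(x, N y)`, and `𝔅_N` a 2-cocycle. -/
def IsHN (mul : A →ₗ[ℝ] A →ₗ[ℝ] A) (B : A →ₗ[ℝ] Dual ℝ A) (N : A →ₗ[ℝ] A) : Prop :=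
  IsSymmB B ∧ IsCocycle mul B ∧ IsNij mul N ∧ (∀ x y : A, B (N x) y = B x (N y)) ∧
  IsCocycle mul (B ∘ₗ N)
theorem nij_aux1 (mul : A →ₗ[ℝ] A →ₗ[ℝ] A) (N : A →ₗ[ℝ] A) (hN : IsNij mul N)
    (b : ℕ) (x y : A) :
    mul (N x) ((N ^ b) y) - N (mul x ((N ^ b) y))
      = (N ^ b) (mul (N x) y) - (N ^ b) (N (mul x y)) := by
  induction b generalizing y with
  | zero => simp
  | succ b ih =>
    have h1 := ih (N y)
    have h2 := hN x y
    simp only [pow_succ, Module.End.mul_apply]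
    rw [h1, h2, ← map_sub, ← map_sub]
    congr 1
    simp only [map_add, map_sub]
    abel

theorem nij_aux2 (mul : A →ₗ[ℝ] A →ₗ[ℝ] A) (N : A →ₗ[ℝ] A) (hN : IsNij mul N)
    (a b : ℕ) (x y : A) :
    mul ((N ^ a) x) ((N ^ b) y) = (N ^ b) (mul ((N ^ a) x) y)
      + (N ^ a) (mul x ((N ^ b) y)) - (N ^ (a + b)) (mul x y) := by
  induction a generalizing x with
  | zero => simp
  | succ a ih =>
    have h1 := ih (N x)
    have h2 := nij_aux1 mul N hN b x y
    have h3 : (N ^ b) (N (mul x y)) = N ((N ^ b) (mul x y)) := by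
      have e := LinearMap.congr_fun ((pow_succ N b).symm.trans (pow_succ' N b)) (mul x y)
      simpa only [Module.End.mul_apply] using e
    rw [h3] at h2
    rw [sub_eq_iff_eq_add] at h2
    have e : N ^ (a + 1 + b) = N ^ a * (N * N ^ b) := by
      rw [← pow_succ', ← pow_add]; congr 1; ring
    rw [e]
    simp only [pow_succ, pow_add, Module.End.mul_apply] at h1 ⊢
    rw [h1, h2]
    simp only [map_add, map_sub]
    abel

theorem nij_aux3 (mul : A →ₗ[ℝ] A →ₗ[ℝ] A) (N : A →ₗ[ℝ] A) (hN : IsNij mul N)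
    (k i : ℕ) (x y : A) :
    (N ^ k) (mulN mul (N ^ (k + i)) x y) = mulN mul (N ^ i) ((N ^ k) x) ((N ^ k) y) := by
  have c : ∀ (a b : ℕ) (z : A), (N ^ a) ((N ^ b) z) = (N ^ (a + b)) z := by
    intro a b z; rw [pow_add, Module.End.mul_apply]
  have m : ∀ (P : A →ₗ[ℝ] A) (x y : A), mulN mul P x y
      = mul (P x) y + mul x (P y) - P (mul x y) := by
    intro P x y; simp [mulN]
  rw [m, m, c, c, nij_aux2 mul N hN (i + k) k, nij_aux2 mul N hN k (i + k),
    nij_aux2 mul N hN k k]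
  simp only [map_add, map_sub, c]
  rw [show k + i = i + k by ring, show i + k + k = k + (i + k) by ring,
    show i + (k + k) = k + (i + k) by ring]
  abel

theorem hs_dualMul (mul : A →ₗ[ℝ] A →ₗ[ℝ] A) (Hs : Dual ℝ A →ₗ[ℝ] A)
    (hsym : IsSymmT Hs) (h : IsKV mul Hs) (α β : Dual ℝ A) :
    Hs (dualMul mul Hs α β) = mul (Hs α) (Hs β) := by
  rw [← sub_eq_zero, ← Module.forall_dual_apply_eq_zero_iff ℝ]
  intro γ
  have h1 := h α γ β
  rw [map_sub, hsym γ]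
  simp only [KVbr, br, map_sub] at h1
  simp only [dualMul, LinearMap.add_apply, LinearMap.neg_apply, LinearMap.comp_apply,
    LinearMap.sub_apply, LinearMap.flip_apply, map_sub]
  linarith

/-- for a KVN-structure `(H,N)` and all `k, i ∈ ℕ`:
`(N^k∘H^♯)(α ·^H_{(N*)^{k+i}} β) = (N^k∘H^♯)(α) ·_{N^i} (N^k∘H^♯)(β)`. -/
theorem powers_hom_of_KVN
    (mul : A →ₗ[ℝ] A →ₗ[ℝ] A) (hls : IsLS mul)
    (Hs : Dual ℝ A →ₗ[ℝ] A) (hsym : IsSymmT Hs)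
    (N : A →ₗ[ℝ] A) (h : IsKVN mul Hs N) :
    ∀ (k i : ℕ) (α β : Dual ℝ A),
      ((N ^ k) ∘ₗ Hs) (dmulE mul Hs (N.dualMap ^ (k + i)) α β)
        = mulN mul (N ^ i) (((N ^ k) ∘ₗ Hs) α) (((N ^ k) ∘ₗ Hs) β) := by
  obtain ⟨hKV, hN, hc, -⟩ := h
  have hc' : ∀ (m : ℕ) (γ : Dual ℝ A), Hs ((N.dualMap ^ m) γ) = (N ^ m) (Hs γ) := by
    intro m
    induction m with
    | zero => intro γ; simp
    | succ m ih =>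
      intro γ
      rw [pow_succ, pow_succ, Module.End.mul_apply, Module.End.mul_apply, ih]
      congr 1
      exact (LinearMap.congr_fun hc γ).symm
  intro k i α β
  rw [LinearMap.comp_apply, LinearMap.comp_apply, LinearMap.comp_apply,
    ← nij_aux3 mul N hN]
  congr 1
  simp [dmulE, mulN, hs_dualMul mul Hs hsym hKV, hc']
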